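/- Let n ∈ ℝ³ be nonzero and let R_n : ℝ³ → ℝ³ be the map R_n v = n × v (cross product). Then the matrix M = P_n J P_n, where P_n = I − (1/|n|²) n nᵀ is the orthogonal projection onto the plane perpendicular to n and J(x,y,z) = (−y,x,0), has purely imaginary eigenvalues ±i n₃/|n| (together with 0), when restricted to the plane {v : n·v = 0}; equivalently, the characteristic polynomial of M is λ(λ² + n₃²/|n|²). -/

import Mathlib

open Matrix Polynomial

theorem stmt_10 (n : Fin 3 → ℝ) (hn : n ≠ 0)
    (P J M : Matrix (Fin 3) (Fin 3) ℝ)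
    (hP : P = 1 - (1 / (∑ i, n i ^ 2)) • Matrix.vecMulVec n n)
    (hJ : J = !![0, -1, 0; 1, 0, 0; 0, 0, 0])
    (hM : M = P * J * P) :
    M.charpoly = X * (X ^ 2 + C ((n 2) ^ 2 / (∑ i, n i ^ 2))) := by
  have hs : n 0 ^ 2 + n 1 ^ 2 + n 2 ^ 2 ≠ 0 := by
    intro h
    apply hn
    funext i
    have h0 := sq_nonneg (n 0)
    have h1 := sq_nonneg (n 1)
    have h2 := sq_nonneg (n 2)
    have : n i ^ 2 = 0 := by
      fin_cases i <;> simp only [Fin.zero_eta, Fin.mk_one, Fin.reduceFinMk] <;> linarith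
    simpa using this
  rw [Fin.sum_univ_three] at *
  obtain ⟨k, hk⟩ : ∃ k, k = n 2 / (n 0 ^ 2 + n 1 ^ 2 + n 2 ^ 2) := ⟨_, rfl⟩
  have hM' : M = !![0, -(k * n 2), k * n 1; k * n 2, 0, -(k * n 0); -(k * n 1), k * n 0, 0] := by
    rw [hM, hP, hJ, hk]
    ext i j
    fin_cases i <;> fin_cases j <;>
      simp [Matrix.mul_apply, Fin.sum_univ_three, Matrix.vecMulVec_apply, Matrix.one_apply] <;>
      field_simp <;> ring
  have hc : n 2 ^ 2 / (n 0 ^ 2 + n 1 ^ 2 + n 2 ^ 2)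
      = (k * n 0) ^ 2 + (k * n 1) ^ 2 + (k * n 2) ^ 2 := by
    rw [hk]; field_simp
  rw [hc, hM', Matrix.charpoly, Matrix.det_fin_three]
  simp [Matrix.charmatrix_apply]
  ring
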